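/- Fixed points versus period-2 cycles: Let x, y ∈ Ω with x ≠ y. Then (x, x) and (y, y) are both fixed points of F if and only if both (x, y) and (y, x) have minimal period 2 under F. -/

import Mathlib

/-- A site of the `L × L` toroidal lattice. -/
abbrev Site (L : ℕ) := ZMod L × ZMod L

/-- The set `Ω` of states: functions on the lattice with values in `{-1, 1}`. -/
def Omega (L : ℕ) := {x : Site L → ℤ // ∀ k, x k = 1 ∨ x k = -1}

namespace Q2R

variable {L : ℕ}

/-- The sum of the four von Neumann neighbors of site `k`. -/
def nbhdSum (x : Site L → ℤ) (k : Site L) : ℤ :=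
  x (k + (1, 0)) + x (k - (1, 0)) + x (k + (0, 1)) + x (k - (0, 1))

/-- The map `φ : Ω → Ω`, detecting null neighborhoods. -/
def phi (x : Omega L) : Omega L :=
  ⟨fun k => if nbhdSum x.1 k = 0 then -1 else 1, fun k => by
    by_cases h : nbhdSum x.1 k = 0 <;> simp [h]⟩

/-- Hadamard (pointwise) product `x ⊙ y`. -/
def had (x y : Omega L) : Omega L :=
  ⟨fun k => x.1 k * y.1 k, fun k => by
    rcases x.2 k with h | h <;> rcases y.2 k with h' | h' <;> simp [h, h']⟩

/-- The constant state `𝟙`. -/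
def one : Omega L := ⟨fun _ => 1, fun _ => Or.inl rfl⟩

/-- Negation: `-x = (-𝟙) ⊙ x`. -/
def neg (x : Omega L) : Omega L := had ⟨fun _ => -1, fun _ => Or.inr rfl⟩ x

/-- The Q2R map `F(x, y) = (y ⊙ φ(x), x)`. -/
def F : Omega L × Omega L → Omega L × Omega L := fun p => (had p.2 (phi p.1), p.1)

/-- The configuration `p` has minimal period `T ≥ 1` under `F`. -/
def IsMinPeriod (p : Omega L × Omega L) (T : ℕ) : Prop :=
  F^[T] p = p ∧ ∀ t, 0 < t → t < T → F^[t] p ≠ p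

/-- The orbit of a configuration under `F`. -/
def orbit (p : Omega L × Omega L) : Set (Omega L × Omega L) :=
  {q | ∃ t : ℕ, F^[t] p = q}

end Q2R

open Q2R

theorem had_eq_left_iff {L : ℕ} (a b : Omega L) : had a b = a ↔ b = one := by
  constructor
  · intro h
    apply Subtype.ext
    funext k
    have hk : a.1 k * b.1 k = a.1 k := congrFun (congrArg Subtype.val h) k
    show b.1 k = 1
    rcases a.2 k with h1 | h1 <;> rw [h1] at hk <;> omega
  · rintro rfl
    apply Subtype.ext
    funext k
    exact mul_one (a.1 k)

/-- Fixed points versus period-2 cycles. -/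
theorem q2r_fp_iff_p2 (L : ℕ) (hL : 2 ≤ L) (hE : Even L) (x y : Omega L)
    (hxy : x ≠ y) :
    (F (x, x) = (x, x) ∧ F (y, y) = (y, y)) ↔
      (IsMinPeriod (x, y) 2 ∧ IsMinPeriod (y, x) 2) := by
  have hfix : ∀ a : Omega L, F (a, a) = (a, a) ↔ phi a = one := by
    intro a
    rw [← had_eq_left_iff a (phi a)]
    simp [F]
  have hper : ∀ a b : Omega L, a ≠ b →
      (IsMinPeriod (a, b) 2 ↔ phi a = one ∧ phi b = one) := by
    intro a b hab
    constructor
    · rintro ⟨h, -⟩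
      have h' : (had a (phi (had b (phi a))), had b (phi a)) = (a, b) := h
      rw [Prod.mk.injEq] at h'
      obtain ⟨h1, h2⟩ := h'
      rw [h2] at h1
      exact ⟨(had_eq_left_iff _ _).1 h2, (had_eq_left_iff _ _).1 h1⟩
    · rintro ⟨ha, hb⟩
      have h2 := (had_eq_left_iff b (phi a)).2 ha
      have h1 := (had_eq_left_iff a (phi b)).2 hb
      refine ⟨?_, ?_⟩
      · show (had a (phi (had b (phi a))), had b (phi a)) = (a, b)
        rw [h2, h1]
      · intro t ht0 ht2 h
        obtain rfl : t = 1 := by omega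
        have h' : (had b (phi a), a) = (a, b) := h
        exact hab (congrArg Prod.snd h')
  rw [hfix, hfix, hper x y hxy, hper y x hxy.symm]
  tauto
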